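/- Let L be a Leibniz superalgebra over K and M a module over L. The assignment sending a degree-0 2-cocycle h ∈ Z₀²(L;M) to the equivalence class of the extension E_h induces a well-defined bijection ω : H₀²(L;M) → F(L,M) between the degree-0 second cohomology group and the set F(L,M) of equivalence classes of extensions of L by M. -/

import Mathlib

open Finset

section Core

variable (K : Type*) [Field K] (L : Type*) [AddCommGroup L] [Module K L]

/-- A (left) Leibniz superalgebra structure on `L` over the field `K`. -/
structure LeibnizSuperStruct where
  grading : ZMod 2 → Submodule K L
  internal : DirectSum.IsInternal grading
  bracket : L →ₗ[K] L →ₗ[K] L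
  bracket_mem : ∀ {α β : ZMod 2} {a b : L},
    a ∈ grading α → b ∈ grading β → bracket a b ∈ grading (α + β)
  leibniz : ∀ {α β : ZMod 2} {a b : L}, a ∈ grading α → b ∈ grading β → ∀ c : L,
    bracket (bracket a b) c =
      bracket a (bracket b c) - ((-1 : K) ^ (α.val * β.val)) • bracket b (bracket a c)

variable {K L}
variable (S : LeibnizSuperStruct K L) (M : Type*) [AddCommGroup M] [Module K M]

/-- A module over a Leibniz superalgebra. -/
structure LeibnizSuperModule where
  grading : ZMod 2 → Submodule K M
  internal : DirectSum.IsInternal grading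
  lact : L →ₗ[K] M →ₗ[K] M
  ract : M →ₗ[K] L →ₗ[K] M
  lact_mem : ∀ {α β : ZMod 2} {a : L} {m : M},
    a ∈ S.grading α → m ∈ grading β → lact a m ∈ grading (α + β)
  ract_mem : ∀ {α β : ZMod 2} {m : M} {a : L},
    m ∈ grading α → a ∈ S.grading β → ract m a ∈ grading (α + β)
  leibniz_lact : ∀ {α β : ZMod 2} {a b : L}, a ∈ S.grading α → b ∈ S.grading β → ∀ m : M,
    lact (S.bracket a b) m
      = lact a (lact b m) - ((-1 : K) ^ (α.val * β.val)) • lact b (lact a m)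
  leibniz_mid : ∀ {α γ : ZMod 2} {a : L} {m : M}, a ∈ S.grading α → m ∈ grading γ → ∀ b : L,
    ract (lact a m) b
      = lact a (ract m b) - ((-1 : K) ^ (α.val * γ.val)) • ract m (S.bracket a b)
  leibniz_ract : ∀ {γ α : ZMod 2} {m : M} {a : L}, m ∈ grading γ → a ∈ S.grading α → ∀ b : L,
    ract (ract m a) b
      = ract m (S.bracket a b) - ((-1 : K) ^ (γ.val * α.val)) • lact a (ract m b)

variable {M} (MS : LeibnizSuperModule S M)

/-- `f ∈ Cⁿ(L;M)` is homogeneous of degree `φ`. -/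
def IsHomogeneousCochain {n : ℕ} (f : MultilinearMap K (fun _ : Fin n => L) M)
    (φ : ZMod 2) : Prop :=
  ∀ (α : Fin n → ZMod 2) (x : Fin n → L), (∀ i, x i ∈ S.grading (α i)) →
    f x ∈ MS.grading ((∑ i, α i) + φ)

/-- The operator `d_x` (for `x` homogeneous of degree `ξ`) on pointwise `n`-cochains of
degree `ψ`, recorded together with the degrees of the (homogeneous) arguments. -/
def Dop {n : ℕ} (x : L) (ξ ψ : ZMod 2)
    (g : (Fin n → ZMod 2) → (Fin n → L) → M) :
    (Fin n → ZMod 2) → (Fin n → L) → M :=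
  fun α z =>
    MS.lact x (g α z) -
      ∑ i : Fin n,
        ((-1 : K) ^ ((ξ * (ψ + ∑ j ∈ Finset.univ.filter (fun j => j < i), α j)).val)) •
          g (Function.update α i (ξ + α i)) (Function.update z i (S.bracket x (z i)))

/-- The coboundary `δⁿ` on pointwise `n`-cochains of degree `ψ`. -/
def Delta {n : ℕ} (ψ : ZMod 2) (g : (Fin n → ZMod 2) → (Fin n → L) → M) :
    (Fin (n + 1) → ZMod 2) → (Fin (n + 1) → L) → M :=
  fun α x =>
    (∑ j : Fin (n + 1), ∑ i ∈ Finset.univ.filter (fun i => i < j),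
        ((-1 : K) ^ (i.val + 1) *
            (-1 : K) ^ ((α i * ∑ l ∈ Finset.univ.filter (fun l => i < l ∧ l < j), α l).val)) •
          g (i.removeNth (Function.update α j (α i + α j)))
            (i.removeNth (Function.update x j (S.bracket (x i) (x j))))) +
    (∑ i ∈ Finset.univ.filter (fun i : Fin (n + 1) => i.val < n),
        ((-1 : K) ^ i.val *
            (-1 : K) ^ ((α i * (ψ + ∑ l ∈ Finset.univ.filter (fun l => l < i), α l)).val)) •
          MS.lact (x i) (g (i.removeNth α) (i.removeNth x))) +
    ((-1 : K) ^ (n + 1)) • MS.ract (g (Fin.init α) (Fin.init x)) (x (Fin.last n))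

end Core

section Ext

universe u v

variable {K : Type v} [Field K] {L M : Type u} [AddCommGroup L] [Module K L]
  [AddCommGroup M] [Module K M]
  (S : LeibnizSuperStruct K L) (MS : LeibnizSuperModule S M)

/-- The bracket `[(x,m),(y,n)] = ([x,y], [x,n] + [m,y] + h(x,y))` on `𝓔 = L ⊕ M`. -/
def extBracket (h : L →ₗ[K] L →ₗ[K] M) : (L × M) →ₗ[K] (L × M) →ₗ[K] (L × M) :=
  LinearMap.mk₂ K
    (fun p q => (S.bracket p.1 q.1, MS.lact p.1 q.2 + MS.ract p.2 q.1 + h p.1 q.1))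
    (by intro p p' q; simp [Prod.ext_iff]; abel)
    (by intro c p q; simp [Prod.ext_iff, smul_add])
    (by intro p q q'; simp [Prod.ext_iff]; abel)
    (by intro c p q; simp [Prod.ext_iff, smul_add])

/-- An extension of `L` by the module `M` (regarded as an abelian Leibniz superalgebra). -/
structure LeibnizExtension where
  E : Type u
  [instAdd : AddCommGroup E]
  [instMod : Module K E]
  T : LeibnizSuperStruct K E
  incl : M →ₗ[K] E
  proj : E →ₗ[K] L
  inj : Function.Injective incl
  surj : Function.Surjective proj
  exact : LinearMap.range incl = LinearMap.ker proj
  incl_grading : ∀ (α : ZMod 2) (m : M), m ∈ MS.grading α → incl m ∈ T.grading α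
  proj_grading : ∀ (α : ZMod 2) (e : E), e ∈ T.grading α → proj e ∈ S.grading α
  proj_bracket : ∀ a b : E, proj (T.bracket a b) = S.bracket (proj a) (proj b)
  compat_left : ∀ (x : E) (m : M), T.bracket x (incl m) = incl (MS.lact (proj x) m)
  compat_right : ∀ (m : M) (x : E), T.bracket (incl m) x = incl (MS.ract m (proj x))

attribute [instance] LeibnizExtension.instAdd LeibnizExtension.instMod

/-- Equivalence of extensions of `L` by `M`. -/
def ExtEquiv (X Y : LeibnizExtension S MS) : Prop :=
  ∃ ψ : X.E ≃ₗ[K] Y.E,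
    (∀ a b : X.E, ψ (X.T.bracket a b) = Y.T.bracket (ψ a) (ψ b))
    ∧ (∀ m : M, ψ (X.incl m) = Y.incl m) ∧ ∀ e : X.E, X.proj e = Y.proj (ψ e)

/-- The set `Z₀²(L;M)` of degree-0 bilinear 2-cocycles. -/
def Z2 : Type _ :=
  {h : L →ₗ[K] L →ₗ[K] M //
    (∀ (α β : ZMod 2) (x y : L), x ∈ S.grading α → y ∈ S.grading β →
      h x y ∈ MS.grading (α + β))
    ∧ ∀ (α β : ZMod 2) (x₁ x₂ : L), x₁ ∈ S.grading α → x₂ ∈ S.grading β → ∀ x₃ : L,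
        -(h (S.bracket x₁ x₂) x₃) - ((-1 : K) ^ (α.val * β.val)) • h x₂ (S.bracket x₁ x₃)
          + h x₁ (S.bracket x₂ x₃) + MS.lact x₁ (h x₂ x₃)
          - ((-1 : K) ^ (α.val * β.val)) • MS.lact x₂ (h x₁ x₃)
          - MS.ract (h x₁ x₂) x₃ = 0}

/-- Two cocycles are cohomologous when they differ by the coboundary `δ¹f` of a degree-0
homogeneous linear map `f : L → M`; `Quot` of this relation is `H₀²(L;M)` as a set. -/
def CohomologousRel (h h' : Z2 S MS) : Prop :=
  ∃ f : L →ₗ[K] M, (∀ (α : ZMod 2) (x : L), x ∈ S.grading α → f x ∈ MS.grading α)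
    ∧ ∀ x₁ x₂ : L,
        h.1 x₁ x₂ - h'.1 x₁ x₂
          = -(f (S.bracket x₁ x₂)) + MS.lact x₁ (f x₂) + MS.ract (f x₁) x₂

theorem exists_gradedProj {K : Type*} [Field K] {E : Type*} [AddCommGroup E] [Module K E]
    (A : ZMod 2 → Submodule K E) (hA : DirectSum.IsInternal A) :
    ∃ P : ZMod 2 → E →ₗ[K] E, (∀ α e, P α e ∈ A α) ∧ (∀ e, P 0 e + P 1 e = e) ∧
      (∀ α e, e ∈ A α → P α e = e) ∧ (∀ α β e, e ∈ A α → β ≠ α → P β e = 0) := by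
  let Φ := LinearEquiv.ofBijective (DirectSum.coeLinearMap A) hA
  have hΦ : ∀ α e (he : e ∈ A α), Φ.symm e = DirectSum.lof K (ZMod 2) (fun i => A i) α ⟨e, he⟩ := by
    intro α e he
    rw [LinearEquiv.symm_apply_eq]
    exact (DirectSum.coeLinearMap_lof A α ⟨e, he⟩).symm
  let P : ZMod 2 → E →ₗ[K] E := fun α => (A α).subtype ∘ₗ
    DirectSum.component K (ZMod 2) (fun i => A i) α ∘ₗ Φ.symm.toLinearMap
  have hP1 : ∀ α e, e ∈ A α → P α e = e := by
    intro α e he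
    simp only [P, LinearMap.comp_apply, LinearEquiv.coe_coe, hΦ α e he,
      DirectSum.component.lof_self]
    rfl
  have hP0 : ∀ α β e, e ∈ A α → β ≠ α → P β e = 0 := by
    intro α β e he hne
    simp only [P, LinearMap.comp_apply, LinearEquiv.coe_coe, hΦ α e he]
    rw [DirectSum.component.of, dif_neg (fun h => hne h.symm)]
    simp
  refine ⟨P, fun α e => Subtype.property _, ?_, hP1, hP0⟩
  intro e
  have hu : (Set.univ : Set (ZMod 2)) = {0, 1} := by
    ext a; revert a; simp only [Set.mem_univ, Set.mem_insert_iff, Set.mem_singleton_iff]; decide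
  have hc := (DirectSum.isInternal_submodule_iff_isCompl A (by decide) hu).1 hA
  have he : e ∈ A 0 ⊔ A 1 := by rw [hc.sup_eq_top]; trivial
  obtain ⟨a, ha, b, hb, rfl⟩ := Submodule.mem_sup.1 he
  rw [map_add, map_add, hP1 0 a ha, hP1 1 b hb, hP0 0 1 a ha (by decide),
    hP0 1 0 b hb (by decide)]
  simp

theorem gradedProj_nat {K : Type*} [Field K] {E F : Type*} [AddCommGroup E] [Module K E]
    [AddCommGroup F] [Module K F] {A : ZMod 2 → Submodule K E} {B : ZMod 2 → Submodule K F}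
    {P : ZMod 2 → E →ₗ[K] E} {Q : ZMod 2 → F →ₗ[K] F}
    (hP : ∀ α e, P α e ∈ A α) (hPs : ∀ e, P 0 e + P 1 e = e)
    (hQ1 : ∀ α e, e ∈ B α → Q α e = e) (hQ0 : ∀ α β e, e ∈ B α → β ≠ α → Q β e = 0)
    (g : E →ₗ[K] F) (hg : ∀ α e, e ∈ A α → g e ∈ B α) (α : ZMod 2) (e : E) :
    Q α (g e) = g (P α e) := by
  have h0 := hg 0 _ (hP 0 e)
  have h1 := hg 1 _ (hP 1 e)
  conv_lhs => rw [← hPs e, map_add, map_add]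
  have hα : α = 0 ∨ α = 1 := by revert α; decide
  rcases hα with rfl | rfl
  · rw [hQ1 0 _ h0, hQ0 1 0 _ h1 (by decide), add_zero]
  · rw [hQ1 1 _ h1, hQ0 0 1 _ h0 (by decide), zero_add]

/-- Homogeneous part of degree zero of a linear map. -/
theorem exists_evenPart {K : Type*} [Field K] {E F : Type*} [AddCommGroup E] [Module K E]
    [AddCommGroup F] [Module K F] {A : ZMod 2 → Submodule K E}
    {P : ZMod 2 → E →ₗ[K] E} (Q : ZMod 2 → F →ₗ[K] F)
    (hP1 : ∀ α e, e ∈ A α → P α e = e) (hP0 : ∀ α β e, e ∈ A α → β ≠ α → P β e = 0)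
    (g : E →ₗ[K] F) : ∃ g' : E →ₗ[K] F, (∀ e, g' e = Q 0 (g (P 0 e)) + Q 1 (g (P 1 e))) ∧
      ∀ α e, e ∈ A α → g' e = Q α (g e) := by
  refine ⟨Q 0 ∘ₗ g ∘ₗ P 0 + Q 1 ∘ₗ g ∘ₗ P 1, fun e => rfl, ?_⟩
  intro α e he
  simp only [LinearMap.add_apply, LinearMap.comp_apply]
  have hα : α = 0 ∨ α = 1 := by clear he; revert α; decide
  rcases hα with rfl | rfl
  · rw [hP1 0 _ he, hP0 0 1 _ he (by decide)]; simp
  · rw [hP1 1 _ he, hP0 1 0 _ he (by decide)]; simp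

theorem prod_internal {K : Type*} [Field K] {E F : Type*} [AddCommGroup E] [Module K E]
    [AddCommGroup F] [Module K F] {A : ZMod 2 → Submodule K E} {B : ZMod 2 → Submodule K F}
    (hA : DirectSum.IsInternal A) (hB : DirectSum.IsInternal B) :
    DirectSum.IsInternal (fun α => (A α).prod (B α)) := by
  have hu : (Set.univ : Set (ZMod 2)) = {0, 1} := by
    ext a; revert a; simp only [Set.mem_univ, Set.mem_insert_iff, Set.mem_singleton_iff]; decide
  have h01 : (0 : ZMod 2) ≠ 1 := by decide
  rw [DirectSum.isInternal_submodule_iff_isCompl _ h01 hu] at hA hB ⊢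
  constructor
  · rw [disjoint_iff, Submodule.prod_inf_prod, hA.inf_eq_bot, hB.inf_eq_bot, Submodule.prod_bot]
  · rw [codisjoint_iff, Submodule.prod_sup_prod, hA.sup_eq_top, hB.sup_eq_top, Submodule.prod_top]

theorem extBracket_apply (h : L →ₗ[K] L →ₗ[K] M) (p q : L × M) :
    extBracket S MS h p q
      = (S.bracket p.1 q.1, MS.lact p.1 q.2 + MS.ract p.2 q.1 + h p.1 q.1) := rfl

/-- The Leibniz superalgebra structure of `E_h`. -/
def extStruct (h : Z2 S MS) : LeibnizSuperStruct K (L × M) where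
  grading := fun α => (S.grading α).prod (MS.grading α)
  internal := prod_internal S.internal MS.internal
  bracket := extBracket S MS h.1
  bracket_mem := by
    rintro α β ⟨x, m⟩ ⟨y, n⟩ ⟨hx, hm⟩ ⟨hy, hn⟩
    exact ⟨S.bracket_mem hx hy, add_mem (add_mem (MS.lact_mem hx hn) (MS.ract_mem hm hy))
      (h.2.1 α β x y hx hy)⟩
  leibniz := by
    rintro α β ⟨x, m⟩ ⟨y, n⟩ ⟨hx, hm⟩ ⟨hy, hn⟩ ⟨z, p⟩
    simp only [extBracket_apply]
    refine Prod.ext (S.leibniz hx hy z) ?_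
    have hc := h.2.2 α β x y hx hy z
    simp only [Prod.snd_sub, Prod.smul_snd, map_add, LinearMap.add_apply]
    rw [MS.leibniz_lact hx hy p, MS.leibniz_mid hx hn z, MS.leibniz_ract hm hy z, ← sub_eq_zero,
      ← neg_eq_zero]
    refine Eq.trans ?_ hc
    module

/-- The extension `E_h`. -/
def extOf (h : Z2 S MS) : LeibnizExtension S MS where
  E := L × M
  T := extStruct S MS h
  incl := LinearMap.inr K L M
  proj := LinearMap.fst K L M
  inj := LinearMap.inr_injective
  surj := LinearMap.fst_surjective
  exact := LinearMap.range_inr K L M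
  incl_grading := fun α m hm => ⟨zero_mem _, hm⟩
  proj_grading := fun α e he => he.1
  proj_bracket := fun a b => rfl
  compat_left := fun x m => by
    simp [extStruct, extBracket_apply]
  compat_right := fun m x => by
    simp [extStruct, extBracket_apply]

theorem extEquiv_equivalence : Equivalence (ExtEquiv S MS) where
  refl X := ⟨LinearEquiv.refl K X.E, fun _ _ => rfl, fun _ => rfl, fun _ => rfl⟩
  symm := by
    rintro X Y ⟨ψ, h1, h2, h3⟩
    refine ⟨ψ.symm, ?_, ?_, ?_⟩
    · intro a b
      rw [LinearEquiv.symm_apply_eq, h1]; simp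
    · intro m
      rw [LinearEquiv.symm_apply_eq, h2]
    · intro e
      rw [h3]; simp
  trans := by
    rintro X Y Z ⟨ψ, h1, h2, h3⟩ ⟨φ, k1, k2, k3⟩
    refine ⟨ψ.trans φ, ?_, ?_, ?_⟩
    · intro a b
      simp [h1, k1]
    · intro m
      simp [h2, k2]
    · intro e
      simp [h3, k3]

theorem extOf_equiv_of_cohomologous (h h' : Z2 S MS) (H : CohomologousRel S MS h h') :
    ExtEquiv S MS (extOf S MS h) (extOf S MS h') := by
  obtain ⟨f, -, hf⟩ := H
  let ψ : (L × M) ≃ₗ[K] (L × M) :=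
    { toFun := fun p => (p.1, p.2 + f p.1)
      invFun := fun p => (p.1, p.2 - f p.1)
      map_add' := by intro p q; ext <;> simp; abel
      map_smul' := by intro c p; ext <;> simp
      left_inv := by intro p; simp
      right_inv := by intro p; simp }
  have hψ : ∀ p, ψ p = (p.1, p.2 + f p.1) := fun p => rfl
  refine ⟨ψ, ?_, ?_, ?_⟩
  · rintro ⟨x, m⟩ ⟨y, n⟩
    change ψ (extBracket S MS h.1 (x, m) (y, n)) = extBracket S MS h'.1 (ψ (x, m)) (ψ (y, n))
    have := hf x y
    rw [sub_eq_iff_eq_add] at this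
    simp only [hψ, extBracket_apply, this, map_add, LinearMap.add_apply]
    refine Prod.ext rfl ?_
    dsimp only
    abel
  · intro m
    change ψ (0, m) = (0, m)
    simp [hψ]
  · intro e
    rfl

theorem cohomologous_of_extOf_equiv (h h' : Z2 S MS)
    (H : ExtEquiv S MS (extOf S MS h) (extOf S MS h')) : CohomologousRel S MS h h' := by
  obtain ⟨ψ', h1', h2', h3'⟩ := H
  let ψ : (L × M) ≃ₗ[K] (L × M) := ψ'
  have h1 : ∀ a b, ψ (extBracket S MS h.1 a b) = extBracket S MS h'.1 (ψ a) (ψ b) := h1'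
  have h2 : ∀ m, ψ (0, m) = (0, m) := h2'
  have h3 : ∀ e, e.1 = (ψ e).1 := h3'
  let f : L →ₗ[K] M := LinearMap.snd K L M ∘ₗ ψ.toLinearMap ∘ₗ LinearMap.inl K L M
  have hψ : ∀ x m, ψ (x, m) = (x, f x + m) := by
    intro x m
    have : ((x, m) : L × M) = (x, 0) + (0, m) := by simp
    rw [this, map_add, h2]
    refine Prod.ext ?_ ?_
    · simp [← h3]
    · rfl
  have hf : ∀ x y, h.1 x y - h'.1 x y
      = -(f (S.bracket x y)) + MS.lact x (f y) + MS.ract (f x) y := by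
    intro x y
    have := congrArg Prod.snd (h1 (x, 0) (y, 0))
    simp only [extBracket_apply, hψ, map_zero, LinearMap.zero_apply, add_zero, zero_add] at this
    rw [eq_comm, ← sub_eq_zero] at this
    rw [← sub_eq_zero, ← neg_eq_zero]
    refine Eq.trans ?_ this
    abel
  obtain ⟨P, hP, hPs, hP1, hP0⟩ := exists_gradedProj _ S.internal
  obtain ⟨Q, hQ, hQs, hQ1, hQ0⟩ := exists_gradedProj _ MS.internal
  obtain ⟨g, -, hg⟩ := exists_evenPart Q hP1 hP0 f
  have hhom : ∀ α β x y, x ∈ S.grading α → y ∈ S.grading β → h.1 x y - h'.1 x y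
      = -(g (S.bracket x y)) + MS.lact x (g y) + MS.ract (g x) y := by
    intro α β x y hx hy
    have e1 := hQ1 (α + β) _ (sub_mem (h.2.1 α β x y hx hy) (h'.2.1 α β x y hx hy))
    rw [← e1, hf, map_add, map_add, map_neg, hg _ _ (S.bracket_mem hx hy), hg _ _ hx, hg _ _ hy]
    have lem : ∀ (u : M →ₗ[K] M) (γ δ : ZMod 2), (∀ ε m, m ∈ MS.grading ε → u m ∈ MS.grading (δ + ε))
        → ∀ m, Q (δ + γ) (u m) = u (Q γ m) := by
      intro u γ δ hu m
      have hγ : γ = 0 ∨ γ = 1 := by clear * -; revert γ; decide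
      have a0 := hu 0 _ (hQ 0 m)
      have a1 := hu 1 _ (hQ 1 m)
      conv_lhs => rw [← hQs m, map_add, map_add]
      rcases hγ with rfl | rfl
      · rw [hQ1 _ _ a0, hQ0 _ _ _ a1 (by simp), add_zero]
      · rw [hQ1 _ _ a1, hQ0 _ _ _ a0 (by simp), zero_add]
    have e2 := lem (MS.lact x) β α (fun ε m hm => MS.lact_mem hx hm) (f y)
    have e3 := lem (MS.ract.flip y) α β (fun ε m hm => by
      rw [add_comm]; exact MS.ract_mem hm hy) (f x)
    simp only [LinearMap.flip_apply] at e3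
    rw [add_comm β α] at e3
    rw [e2, e3]
  refine ⟨g, fun α x hx => by rw [hg α x hx]; exact hQ _ _, ?_⟩
  intro x y
  have k00 := hhom 0 0 _ _ (hP 0 x) (hP 0 y)
  have k01 := hhom 0 1 _ _ (hP 0 x) (hP 1 y)
  have k10 := hhom 1 0 _ _ (hP 1 x) (hP 0 y)
  have k11 := hhom 1 1 _ _ (hP 1 x) (hP 1 y)
  have key : ∀ a b c d : L,
      h.1 a c - h'.1 a c = -(g (S.bracket a c)) + MS.lact a (g c) + MS.ract (g a) c →
      h.1 a d - h'.1 a d = -(g (S.bracket a d)) + MS.lact a (g d) + MS.ract (g a) d →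
      h.1 b c - h'.1 b c = -(g (S.bracket b c)) + MS.lact b (g c) + MS.ract (g b) c →
      h.1 b d - h'.1 b d = -(g (S.bracket b d)) + MS.lact b (g d) + MS.ract (g b) d →
      h.1 (a + b) (c + d) - h'.1 (a + b) (c + d) = -(g (S.bracket (a + b) (c + d)))
        + MS.lact (a + b) (g (c + d)) + MS.ract (g (a + b)) (c + d) := by
    intro a b c d q1 q2 q3 q4
    simp only [map_add, LinearMap.add_apply]
    have := congrArg₂ (· + ·) (congrArg₂ (· + ·) q1 q2) (congrArg₂ (· + ·) q3 q4)
    refine Eq.trans ?_ (this.trans ?_)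
    · abel
    · abel
  have := key _ _ _ _ k00 k01 k10 k11
  rwa [hPs, hPs] at this

theorem exists_extOf_equiv (X : LeibnizExtension S MS) :
    ∃ h : Z2 S MS, ExtEquiv S MS (extOf S MS h) X := by
  obtain ⟨P, hP, hPs, hP1, hP0⟩ := exists_gradedProj _ S.internal
  obtain ⟨Q, hQ, hQs, hQ1, hQ0⟩ := exists_gradedProj _ MS.internal
  obtain ⟨R, hR, hRs, hR1, hR0⟩ := exists_gradedProj _ X.T.internal
  obtain ⟨s₀, hs₀⟩ := X.proj.exists_rightInverse_of_surjective (LinearMap.range_eq_top.2 X.surj)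
  obtain ⟨r, hr⟩ := X.incl.exists_leftInverse_of_injective (LinearMap.ker_eq_bot.2 X.inj)
  have hs₀' : ∀ x, X.proj (s₀ x) = x := fun x => LinearMap.congr_fun hs₀ x
  have hr' : ∀ m, r (X.incl m) = m := fun m => LinearMap.congr_fun hr m
  obtain ⟨s, hs, hsα⟩ := exists_evenPart R hP1 hP0 s₀
  have ps : ∀ x, X.proj (s x) = x := by
    intro x
    rw [hs, map_add, ← gradedProj_nat hR hRs hP1 hP0 X.proj X.proj_grading,
      ← gradedProj_nat hR hRs hP1 hP0 X.proj X.proj_grading, hs₀', hs₀', hP1 _ _ (hP _ _),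
      hP1 _ _ (hP _ _), hPs]
  have smem : ∀ α x, x ∈ S.grading α → s x ∈ X.T.grading α := by
    intro α x hx
    rw [hsα α x hx]; exact hR _ _
  have ir : ∀ e, X.proj e = 0 → X.incl (r e) = e := by
    intro e he
    have : e ∈ LinearMap.range X.incl := by rw [X.exact]; exact he
    obtain ⟨m, rfl⟩ := this
    rw [hr']
  have imem : ∀ α m, X.incl m ∈ X.T.grading α → m ∈ MS.grading α := by
    intro α m hm
    have := gradedProj_nat hQ hQs hR1 hR0 X.incl X.incl_grading α m
    rw [hR1 _ _ hm] at this
    rw [X.inj this]; exact hQ _ _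
  let h : L →ₗ[K] L →ₗ[K] M := (X.T.bracket.compl₁₂ s s - S.bracket.compr₂ s).compr₂ r
  have hh : ∀ x y, X.incl (h x y) = X.T.bracket (s x) (s y) - s (S.bracket x y) := by
    intro x y
    change X.incl (r (X.T.bracket (s x) (s y) - s (S.bracket x y))) = _
    apply ir
    rw [map_sub, X.proj_bracket, ps, ps, ps, sub_self]
  have hl : ∀ x m, X.incl (MS.lact x m) = X.T.bracket (s x) (X.incl m) := by
    intro x m
    rw [X.compat_left, ps]
  have hrr : ∀ m x, X.incl (MS.ract m x) = X.T.bracket (X.incl m) (s x) := by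
    intro m x
    rw [X.compat_right, ps]
  let H : Z2 S MS := ⟨h, by
    intro α β x y hx hy
    apply imem
    rw [hh]
    exact sub_mem (X.T.bracket_mem (smem _ _ hx) (smem _ _ hy)) (smem _ _ (S.bracket_mem hx hy)), by
    intro α β x y hx hy z
    apply X.inj
    simp only [map_add, map_sub, map_neg, map_smul, map_zero, hl, hrr, hh, LinearMap.sub_apply]
    rw [X.T.leibniz (smem _ _ hx) (smem _ _ hy), S.leibniz hx hy]
    simp only [map_sub, map_smul]
    module⟩
  refine ⟨H, ?_⟩
  let φ : (L × M) →ₗ[K] X.E := s.coprod X.incl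
  have hφ : ∀ x m, φ (x, m) = s x + X.incl m := fun x m => by simp [φ]
  have pi : ∀ m, X.proj (X.incl m) = 0 := by
    intro m
    have : X.incl m ∈ LinearMap.ker X.proj := by rw [← X.exact]; exact ⟨m, rfl⟩
    exact this
  have pφ : ∀ q, X.proj (φ q) = q.1 := by
    rintro ⟨x, m⟩
    rw [hφ, map_add, ps, pi, add_zero]
  have bij : Function.Bijective φ := by
    constructor
    · rw [injective_iff_map_eq_zero]
      rintro ⟨x, m⟩ h0
      have hx : x = 0 := by
        have := pφ (x, m)
        rw [h0, map_zero] at this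
        exact this.symm
      subst hx
      rw [hφ, map_zero, zero_add] at h0
      have : m = 0 := X.inj (by rw [h0, map_zero])
      rw [this]; rfl
    · intro e
      refine ⟨(X.proj e, r (e - s (X.proj e))), ?_⟩
      rw [hφ, ir _ (by rw [map_sub, ps, sub_self])]
      abel
  refine ⟨LinearEquiv.ofBijective φ bij, ?_, ?_, ?_⟩
  · rintro ⟨x, m⟩ ⟨y, n⟩
    change φ (extBracket S MS h (x, m) (y, n)) = X.T.bracket (φ (x, m)) (φ (y, n))
    have z : X.T.bracket (X.incl m) (X.incl n) = 0 := by
      rw [X.compat_left, pi]; simp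
    simp only [extBracket_apply, hφ, map_add, LinearMap.add_apply, hl, hrr, hh, z]
    abel
  · intro m
    change φ (0, m) = _
    rw [hφ, map_zero, zero_add]
  · intro e
    exact (pφ e).symm

theorem stmt12 :
    ∃ ω : Quot (CohomologousRel S MS) → Quot (ExtEquiv S MS),
      Function.Bijective ω
      ∧ ∀ (h : Z2 S MS) (X : LeibnizExtension S MS),
          (∃ ψ : (L × M) ≃ₗ[K] X.E,
            (∀ a b : L × M, ψ (extBracket S MS h.1 a b) = X.T.bracket (ψ a) (ψ b))
            ∧ (∀ m : M, ψ (0, m) = X.incl m) ∧ ∀ q : L × M, X.proj (ψ q) = q.1) →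
          ω (Quot.mk _ h) = Quot.mk _ X := by
  refine ⟨Quot.lift (fun h => Quot.mk _ (extOf S MS h))
    (fun h h' H => Quot.sound (extOf_equiv_of_cohomologous S MS h h' H)), ⟨?_, ?_⟩, ?_⟩
  · rintro ⟨h⟩ ⟨h'⟩ H
    have H' : Quot.mk (ExtEquiv S MS) (extOf S MS h) = Quot.mk _ (extOf S MS h') := H
    exact Quot.sound (cohomologous_of_extOf_equiv S MS h h'
      ((extEquiv_equivalence S MS).eqvGen_iff.1 (Quot.eqvGen_exact H')))
  · rintro ⟨X⟩
    obtain ⟨h, hX⟩ := exists_extOf_equiv S MS X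
    exact ⟨Quot.mk _ h, Quot.sound hX⟩
  · rintro h X ⟨ψ, h1, h2, h3⟩
    exact Quot.sound ⟨ψ, h1, h2, fun e => (h3 e).symm⟩

end Ext
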